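/- Let c ≥ 1 and let p be a prime, and suppose n = k·p for some positive integer k with p ∤ k and k ≠ c+1, and n ≥ (2c+3)². Then e_{n−1−c}(n) ≡ 0 (mod p). -/

import Mathlib

/-- `esymm k n` is the sum of the products of all `k`-element subsets of `{1, …, n-1}`. -/
def esymm (k n : ℕ) : ℕ :=
  ∑ S ∈ (Finset.Icc 1 (n - 1)).powersetCard k, ∏ i ∈ S, i

open Polynomial in
/-- Over `𝔽_p`, the product of `X + i` over a complete residue system is `X ^ p - X`. -/
theorem prod_range_X_add_natCast_zmod (p : ℕ) [Fact p.Prime] :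
    ∏ i ∈ Finset.range p, (X + C (i : ZMod p)) = X ^ p - X := by
  have hp : 1 < p := (Fact.out : p.Prime).one_lt
  have hroots : (X ^ p - X : (ZMod p)[X]).roots = Finset.univ.val := by
    simpa [ZMod.card] using FiniteField.roots_X_pow_card_sub_X (ZMod p)
  have hdeg : (X ^ p - X : (ZMod p)[X]).natDegree = p :=
    FiniteField.X_pow_card_sub_X_natDegree_eq _ hp
  have hmonic : (X ^ p - X : (ZMod p)[X]).Monic :=
    monic_X_pow_sub (by rw [degree_X]; exact_mod_cast hp)
  calc ∏ i ∈ Finset.range p, (X + C (i : ZMod p))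
      = ∏ a : ZMod p, (X + C a) :=
        Finset.prod_nbij' (fun i => (i : ZMod p)) ZMod.val (by simp)
          (fun a _ => Finset.mem_range.2 a.val_lt)
          (fun i hi => ZMod.val_cast_of_lt (Finset.mem_range.1 hi))
          (fun a _ => ZMod.natCast_zmod_val a) (fun _ _ => rfl)
    _ = ∏ a : ZMod p, (X - C a) :=
        Fintype.prod_equiv (Equiv.neg _) _ _ (by simp)
    _ = X ^ p - X := by
        have := prod_multiset_X_sub_C_of_monic_of_roots_card_eq hmonic
          (by rw [hroots, hdeg]; simp [ZMod.card])
        rwa [hroots] at this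

open Polynomial in
theorem prod_range_mul_X_add_natCast_zmod (p k : ℕ) [Fact p.Prime] :
    ∏ i ∈ Finset.range (k * p), (X + C (i : ZMod p)) = (X ^ p - X) ^ k := by
  induction k with
  | zero => simp
  | succ k ih =>
    rw [Nat.succ_mul, Finset.prod_range_add, ih, pow_succ, ← prod_range_X_add_natCast_zmod]
    simp

open Polynomial in
theorem natCast_esymm_eq_coeff {R : Type*} [CommRing R] {c n : ℕ} (hn : c < n) :
    (esymm (n - 1 - c) n : R) = (∏ i ∈ Finset.range n, (X + C (i : R))).coeff (c + 1) := by
  obtain ⟨m, rfl⟩ : ∃ m, n = m + 1 := ⟨n - 1, by omega⟩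
  have hIcc : ∏ i ∈ Finset.Icc 1 m, (X + C (i : R)) =
      ∏ i ∈ Finset.range m, (X + C ((i + 1 : ℕ) : R)) := by
    rw [Finset.range_eq_Ico, Finset.prod_Ico_add' (fun i : ℕ => X + C (i : R)) 0 m 1]
    rfl
  rw [Finset.prod_range_succ', ← hIcc, Nat.cast_zero, C_0, add_zero, coeff_mul_X,
    Finset.prod_X_add_C_coeff _ _ (by simp; omega)]
  simp [esymm]

open Polynomial in
/-- `(X ^ p - X) ^ k` has no terms of degree less than `k + (p - 1)` except in degree `k`. -/
theorem coeff_X_pow_sub_X_pow_eq_zero {R : Type*} [CommRing R] {p k m : ℕ} (hp : 1 < p)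
    (hne : k ≠ m) (hm : m < k + (p - 1)) : ((X ^ p - X : R[X]) ^ k).coeff m = 0 := by
  have h : (X ^ p - X : R[X]) ^ k = X ^ k * expand R (p - 1) ((X - 1) ^ k) := by
    obtain ⟨q, rfl⟩ : ∃ q, p = q + 1 := ⟨p - 1, by omega⟩
    simp only [map_pow, map_sub, expand_X, map_one, ← mul_pow, Nat.add_sub_cancel]
    ring
  rw [h, coeff_X_pow_mul']
  split_ifs with hkm
  · rw [coeff_expand (by omega), if_neg]
    intro hd
    have := Nat.le_of_dvd (by omega) hd
    omega
  · rfl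

theorem stmt_12 (c p n k : ℕ) (hc : 1 ≤ c) (hp : p.Prime) (hk : 1 ≤ k)
    (hn : n = k * p) (hpk : ¬ p ∣ k) (hkc : k ≠ c + 1) (hbig : (2 * c + 3) ^ 2 ≤ n) :
    esymm (n - 1 - c) n ≡ 0 [MOD p] := by
  have : Fact p.Prime := ⟨hp⟩
  have hlt : c + 1 < k + (p - 1) := by
    by_contra! hle
    have h1 : k ≤ c + 1 := by omega
    have h2 : p ≤ c + 2 := by omega
    nlinarith [Nat.mul_le_mul h1 h2]
  rw [← ZMod.natCast_eq_natCast_iff, natCast_esymm_eq_coeff (by nlinarith), hn,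
    prod_range_mul_X_add_natCast_zmod, coeff_X_pow_sub_X_pow_eq_zero hp.one_lt hkc hlt,
    Nat.cast_zero]
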